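/- (Bounds on the phase derivatives on the truncated frequency domain) For ξ = (ξ₁,ξ₂,ξ₃) ∈ ℝ³ with ξ ≠ 0, set γ_A(ξ) = ξ₂ξ₃(1 + √(4|ξ|² + 1))/(2|ξ|³√(4|ξ|² + 1)) and γ_B(ξ) = ξ₂ξ₃(1 − √(4|ξ|² + 1))/(2|ξ|³√(4|ξ|² + 1)). For every β ≥ 1 there exist a constant C_β > 0 and R₀ > 0 such that for every R ≥ R₀, setting r = R^{−β}, for all ξ in the set C_{r/2, 2R} = {ξ ∈ ℝ³ : r/2 ≤ |ξ_h| ≤ 2R, r/2 ≤ |ξ₃| ≤ 2R, r/2 ≤ |ξ| ≤ 2R}: (i) C_β^{−1} R^{−3−β} |ξ₂| ≤ |γ_A(ξ)| ≤ C_β R^β and C_β^{−1} R^{−3−β} |ξ₂| ≤ |γ_B(ξ)| ≤ C_β R^β; (ii) |∂_{ξ₂}γ_A(ξ)| ≤ C_β R^{2β} and |∂_{ξ₂}γ_B(ξ)| ≤ C_β R^{2β}. -/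

import Mathlib

/- Bounds on the phase derivatives `γ_A`, `γ_B` (and their `ξ₂`-derivatives) on the truncated
frequency domain `C_{r/2, 2R}` with `r = R^{-β}`. -/

open Real
noncomputable section

/-- `γ_A(ξ) = ξ₂ξ₃(1 + √(4|ξ|² + 1))/(2|ξ|³√(4|ξ|² + 1))`. -/
def gammaA (ξ₁ ξ₂ ξ₃ : ℝ) : ℝ :=
  ξ₂ * ξ₃ * (1 + Real.sqrt (4 * (ξ₁^2 + ξ₂^2 + ξ₃^2) + 1)) /
    (2 * (Real.sqrt (ξ₁^2 + ξ₂^2 + ξ₃^2))^3 * Real.sqrt (4 * (ξ₁^2 + ξ₂^2 + ξ₃^2) + 1))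

/-- `γ_B(ξ) = ξ₂ξ₃(1 - √(4|ξ|² + 1))/(2|ξ|³√(4|ξ|² + 1))`. -/
def gammaB (ξ₁ ξ₂ ξ₃ : ℝ) : ℝ :=
  ξ₂ * ξ₃ * (1 - Real.sqrt (4 * (ξ₁^2 + ξ₂^2 + ξ₃^2) + 1)) /
    (2 * (Real.sqrt (ξ₁^2 + ξ₂^2 + ξ₃^2))^3 * Real.sqrt (4 * (ξ₁^2 + ξ₂^2 + ξ₃^2) + 1))

/-- The common form of `γ_A` (`ε = 1`) and `γ_B` (`ε = -1`). -/
def gammaSign (ε ξ₁ ξ₂ ξ₃ : ℝ) : ℝ :=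
  ξ₂ * ξ₃ * (1 + ε * √(4 * (ξ₁^2 + ξ₂^2 + ξ₃^2) + 1)) /
    (2 * (√(ξ₁^2 + ξ₂^2 + ξ₃^2))^3 * √(4 * (ξ₁^2 + ξ₂^2 + ξ₃^2) + 1))

lemma gammaA_eq_gammaSign (x y z : ℝ) : gammaA x y z = gammaSign 1 x y z := by
  simp [gammaA, gammaSign]

lemma gammaB_eq_gammaSign (x y z : ℝ) : gammaB x y z = gammaSign (-1) x y z := by
  simp [gammaB, gammaSign, sub_eq_add_neg]

lemma abs_one_add_mul_div_le_two {ε s : ℝ} (hε : |ε| ≤ 1) (hs : 1 ≤ s) :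
    |(1 + ε * s) / s| ≤ 2 := by
  have hs0 : 0 < s := by linarith
  rw [abs_div, abs_of_pos hs0, div_le_iff₀ hs0, abs_le]
  obtain ⟨h1, h2⟩ := abs_le.mp hε
  constructor <;> nlinarith

lemma hasDerivAt_gammaSign (ε x y z : ℝ) (hq : 0 < x^2 + y^2 + z^2) :
    HasDerivAt (fun t => gammaSign ε x t z)
      ((√(x^2 + y^2 + z^2) ^ 2)⁻¹ *
        (z / √(x^2 + y^2 + z^2) *
            ((1 + ε * √(4 * (x^2 + y^2 + z^2) + 1)) / √(4 * (x^2 + y^2 + z^2) + 1)) / 2 -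
          3 * (y / √(x^2 + y^2 + z^2)) ^ 2 * (z / √(x^2 + y^2 + z^2)) *
            ((1 + ε * √(4 * (x^2 + y^2 + z^2) + 1)) / √(4 * (x^2 + y^2 + z^2) + 1)) / 2 -
          2 * (y / √(x^2 + y^2 + z^2)) ^ 2 * (z / √(x^2 + y^2 + z^2)) *
            (√(x^2 + y^2 + z^2) ^ 2 / √(4 * (x^2 + y^2 + z^2) + 1) ^ 3))) y := by
  have hq' : HasDerivAt (fun t : ℝ => x^2 + t^2 + z^2) (2 * y) y := by
    simpa using ((hasDerivAt_pow 2 y).const_add (x^2)).add_const (z^2)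
  have hn := hq'.sqrt hq.ne'
  have hs := ((hq'.const_mul 4).add_const 1).sqrt (by positivity)
  have hn0 : 0 < √(x^2 + y^2 + z^2) := Real.sqrt_pos.mpr hq
  have hs0 : 0 < √(4 * (x^2 + y^2 + z^2) + 1) := Real.sqrt_pos.mpr (by positivity)
  have hnum := ((hasDerivAt_id y).mul_const z).mul ((hs.const_mul ε).const_add 1)
  have hden := ((hn.pow 3).const_mul 2).mul hs
  refine (hnum.div hden (by simp only [Pi.mul_apply, Pi.pow_apply]; positivity)).congr_deriv ?_
  simp only [Pi.mul_apply, Pi.pow_apply, id]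
  generalize √(x^2 + y^2 + z^2) = n at *
  generalize √(4 * (x^2 + y^2 + z^2) + 1) = s at *
  field_simp
  ring

lemma abs_deriv_gammaSign_le {ε x y z : ℝ} (hε : |ε| ≤ 1) (hq : 0 < x^2 + y^2 + z^2) :
    |deriv (fun t => gammaSign ε x t z) y| ≤ 5 * (√(x^2 + y^2 + z^2) ^ 2)⁻¹ := by
  rw [(hasDerivAt_gammaSign ε x y z hq).deriv]
  have hn0 : 0 < √(x^2 + y^2 + z^2) := Real.sqrt_pos.mpr hq
  have hs1 : 1 ≤ √(4 * (x^2 + y^2 + z^2) + 1) := Real.one_le_sqrt.mpr (by linarith)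
  have hn2 : √(x^2 + y^2 + z^2) ^ 2 = x^2 + y^2 + z^2 := Real.sq_sqrt hq.le
  have hs2 : √(4 * (x^2 + y^2 + z^2) + 1) ^ 2 = 4 * √(x^2 + y^2 + z^2) ^ 2 + 1 := by
    rw [hn2, Real.sq_sqrt (by positivity)]
  have hk := abs_one_add_mul_div_le_two hε hs1
  have ha : |z / √(x^2 + y^2 + z^2)| ≤ 1 := by
    rw [abs_div, abs_of_pos hn0, div_le_one hn0]
    exact Real.abs_le_sqrt (by nlinarith)
  have hb : |y / √(x^2 + y^2 + z^2)| ≤ 1 := by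
    rw [abs_div, abs_of_pos hn0, div_le_one hn0]
    exact Real.abs_le_sqrt (by nlinarith)
  generalize √(x^2 + y^2 + z^2) = n at *
  generalize √(4 * (x^2 + y^2 + z^2) + 1) = s at *
  have hs0 : 0 < s := by linarith
  have hw : |n ^ 2 / s ^ 3| ≤ 1 / 4 := by
    rw [abs_of_nonneg (by positivity), div_le_iff₀ (by positivity)]
    nlinarith [mul_le_mul_of_nonneg_right hs1 (sq_nonneg s)]
  generalize (1 + ε * s) / s = k at *
  generalize z / n = a at *
  generalize y / n = b at *
  generalize n ^ 2 / s ^ 3 = w at *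
  rw [abs_mul, abs_of_nonneg (by positivity : 0 ≤ (n ^ 2)⁻¹), mul_comm]
  refine mul_le_mul_of_nonneg_right ?_ (by positivity)
  have hb2 : |b| ^ 2 ≤ 1 := pow_le_one₀ (abs_nonneg b) hb
  have hab : |b| ^ 2 * |a| ≤ 1 := mul_le_one₀ hb2 (abs_nonneg a) ha
  have h1 : |a * k / 2| ≤ 1 := by
    rw [abs_div, abs_mul, abs_two]
    have := mul_le_mul ha hk (abs_nonneg k) zero_le_one
    linarith
  have h2 : |3 * b ^ 2 * a * k / 2| ≤ 3 := by
    have := mul_le_mul hab hk (abs_nonneg k) zero_le_one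
    have h : |3 * b ^ 2 * a * k / 2| = 3 * (|b| ^ 2 * |a| * |k|) / 2 := by
      simp only [abs_div, abs_mul, abs_pow, Nat.abs_ofNat]
      ring
    linarith
  have h3 : |2 * b ^ 2 * a * w| ≤ 1 / 2 := by
    have := mul_le_mul hab hw (abs_nonneg w) zero_le_one
    have h : |2 * b ^ 2 * a * w| = 2 * (|b| ^ 2 * |a| * |w|) := by
      simp only [abs_mul, abs_pow, abs_two]
      ring
    linarith
  have h4 := abs_sub (a * k / 2 - 3 * b ^ 2 * a * k / 2) (2 * b ^ 2 * a * w)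
  have h5 := abs_sub (a * k / 2) (3 * b ^ 2 * a * k / 2)
  linarith

lemma abs_gammaSign_le {ε x y z : ℝ} (hε : |ε| ≤ 1) (hq : 0 < x^2 + y^2 + z^2) :
    |gammaSign ε x y z| ≤ (√(x^2 + y^2 + z^2))⁻¹ := by
  unfold gammaSign
  have hn0 : 0 < √(x^2 + y^2 + z^2) := Real.sqrt_pos.mpr hq
  have hs1 : 1 ≤ √(4 * (x^2 + y^2 + z^2) + 1) := Real.one_le_sqrt.mpr (by linarith)
  have hk := abs_one_add_mul_div_le_two hε hs1
  have hy : |y| ≤ √(x^2 + y^2 + z^2) := Real.abs_le_sqrt (by nlinarith)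
  have hz : |z| ≤ √(x^2 + y^2 + z^2) := Real.abs_le_sqrt (by nlinarith)
  generalize √(x^2 + y^2 + z^2) = n at *
  generalize √(4 * (x^2 + y^2 + z^2) + 1) = s at *
  have hs0 : 0 < s := by linarith
  have h : y * z * (1 + ε * s) / (2 * n ^ 3 * s) = y * z * ((1 + ε * s) / s) / (2 * n ^ 3) := by
    field_simp
  rw [h, abs_div, abs_mul, abs_mul, abs_of_pos (by positivity : 0 < 2 * n ^ 3),
    div_le_iff₀ (by positivity)]
  calc |y| * |z| * |(1 + ε * s) / s| ≤ n * n * 2 := by gcongr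
    _ = n⁻¹ * (2 * n ^ 3) := by field_simp

lemma le_abs_gammaSign {ε x y z : ℝ} (hε : ε = 1 ∨ ε = -1) (hq : 0 < x^2 + y^2 + z^2)
    {R : ℝ} (hR : 1 ≤ R) (hnR : √(x^2 + y^2 + z^2) ≤ 2 * R) :
    |y| * |z| / (30 * R ^ 3) ≤ |gammaSign ε x y z| := by
  unfold gammaSign
  have hn0 : 0 < √(x^2 + y^2 + z^2) := Real.sqrt_pos.mpr hq
  have hs1 : 1 ≤ √(4 * (x^2 + y^2 + z^2) + 1) := Real.one_le_sqrt.mpr (by linarith)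
  have hs2 : √(4 * (x^2 + y^2 + z^2) + 1) ^ 2 = 4 * √(x^2 + y^2 + z^2) ^ 2 + 1 := by
    rw [Real.sq_sqrt hq.le, Real.sq_sqrt (by positivity)]
  generalize √(x^2 + y^2 + z^2) = n at *
  generalize √(4 * (x^2 + y^2 + z^2) + 1) = s at *
  have hs0 : 0 < s := by linarith
  have hR0 : 0 < R := by linarith
  have hs5 : s ≤ 5 * R := by nlinarith
  have hfactor : 4 * n ^ 2 / (1 + s) ≤ |1 + ε * s| := by
    rw [div_le_iff₀ (by linarith)]
    rcases hε with rfl | rfl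
    · rw [abs_of_pos (by linarith)]
      nlinarith
    · rw [abs_of_nonpos (by linarith)]
      nlinarith
  rw [abs_div, abs_mul, abs_mul, abs_of_pos (by positivity : 0 < 2 * n ^ 3 * s)]
  have hden : n * s * (1 + s) ≤ 2 * R * (5 * R) * (6 * R) := by
    gcongr
    linarith
  calc |y| * |z| / (30 * R ^ 3) = |y| * |z| * (2 / (2 * R * (5 * R) * (6 * R))) := by
        field_simp
        ring
    _ ≤ |y| * |z| * (2 / (n * s * (1 + s))) := by gcongr
    _ = |y| * |z| * (4 * n ^ 2 / (1 + s)) / (2 * n ^ 3 * s) := by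
        field_simp
        norm_num
    _ ≤ |y| * |z| * |1 + ε * s| / (2 * n ^ 3 * s) := by gcongr

theorem phase_derivative_bounds_truncated_domain (β : ℝ) (hβ : 1 ≤ β) :
    ∃ C > (0:ℝ), ∃ R₀ > (0:ℝ), ∀ R : ℝ, R₀ ≤ R → ∀ ξ₁ ξ₂ ξ₃ : ℝ,
      (R ^ (-β) / 2 ≤ Real.sqrt (ξ₁^2 + ξ₂^2) ∧ Real.sqrt (ξ₁^2 + ξ₂^2) ≤ 2 * R) →
      (R ^ (-β) / 2 ≤ |ξ₃| ∧ |ξ₃| ≤ 2 * R) →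
      (R ^ (-β) / 2 ≤ Real.sqrt (ξ₁^2 + ξ₂^2 + ξ₃^2) ∧
        Real.sqrt (ξ₁^2 + ξ₂^2 + ξ₃^2) ≤ 2 * R) →
      (C⁻¹ * R ^ (-3 - β) * |ξ₂| ≤ |gammaA ξ₁ ξ₂ ξ₃| ∧ |gammaA ξ₁ ξ₂ ξ₃| ≤ C * R ^ β) ∧
      (C⁻¹ * R ^ (-3 - β) * |ξ₂| ≤ |gammaB ξ₁ ξ₂ ξ₃| ∧ |gammaB ξ₁ ξ₂ ξ₃| ≤ C * R ^ β) ∧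
      |deriv (fun y : ℝ => gammaA ξ₁ y ξ₃) ξ₂| ≤ C * R ^ (2 * β) ∧
      |deriv (fun y : ℝ => gammaB ξ₁ y ξ₃) ξ₂| ≤ C * R ^ (2 * β) := by
  refine ⟨60, by norm_num, 1, one_pos, ?_⟩
  rintro R hR x y z - ⟨hz, -⟩ ⟨hn, hnR⟩
  have hR0 : 0 < R := by linarith
  have hβpos : 0 < R ^ β := Real.rpow_pos_of_pos hR0 β
  have hr : 0 < R ^ (-β) := Real.rpow_pos_of_pos hR0 _
  have hn0 : 0 < √(x^2 + y^2 + z^2) := by linarith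
  have hq : 0 < x^2 + y^2 + z^2 := Real.sqrt_pos.mp hn0
  have hinv : (√(x^2 + y^2 + z^2))⁻¹ ≤ 2 * R ^ β := by
    rw [inv_le_comm₀ hn0 (by positivity)]
    rw [Real.rpow_neg hR0.le] at hn
    rw [mul_inv]
    linarith
  have hlower : ∀ ε : ℝ, ε = 1 ∨ ε = -1 →
      (60 : ℝ)⁻¹ * R ^ (-3 - β) * |y| ≤ |gammaSign ε x y z| := by
    intro ε hε
    refine le_trans ?_ (le_abs_gammaSign hε hq hR hnR)
    have hpow : R ^ (-3 - β) = R ^ (-β) / R ^ 3 := by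
      rw [← Real.rpow_natCast R 3, ← Real.rpow_sub hR0]
      congr 1
      push_cast
      ring
    calc (60 : ℝ)⁻¹ * R ^ (-3 - β) * |y| = |y| * (R ^ (-β) / 2) / (30 * R ^ 3) := by
          rw [hpow]
          field_simp
          ring
      _ ≤ |y| * |z| / (30 * R ^ 3) := by gcongr
  have hupper : ∀ ε : ℝ, |ε| ≤ 1 → |gammaSign ε x y z| ≤ 60 * R ^ β := by
    intro ε hε
    linarith [abs_gammaSign_le hε hq]
  have hderiv : ∀ ε : ℝ, |ε| ≤ 1 →
      |deriv (fun t => gammaSign ε x t z) y| ≤ 60 * R ^ (2 * β) := by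
    intro ε hε
    have h2 : R ^ (2 * β) = (R ^ β) ^ 2 := by
      rw [mul_comm, Real.rpow_mul hR0.le, Real.rpow_two]
    have h3 := pow_le_pow_left₀ (by positivity) hinv 2
    rw [inv_pow, mul_pow] at h3
    rw [h2]
    nlinarith [abs_deriv_gammaSign_le hε hq, sq_nonneg (R ^ β)]
  simp only [gammaA_eq_gammaSign, gammaB_eq_gammaSign]
  exact ⟨⟨hlower 1 (.inl rfl), hupper 1 (by simp)⟩, ⟨hlower (-1) (.inr rfl), hupper (-1) (by simp)⟩,
    hderiv 1 (by simp), hderiv (-1) (by simp)⟩
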